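/- arXiv:0804.2300 — 2 statements merged into one kernel-verified Lean document; each statement's English description precedes it below -/
import Mathlib

section
/- Let Γ be a finite connected simple graph with Euler characteristic 0 (the number of vertices equals the number e of edges), whose unique simple cycle has length k ≥ 5, and let ℓ be the number of leaves of Γ. Then Out(A_Γ) contains a free abelian subgroup of rank e − k + 2ℓ. (This is the lower-bound half of the theorem that in this situation vcd(Out(A_Γ)) = e − k + 2ℓ.) -/
/-- The relators of a right-angled Artin group: commutators of adjacent generators. -/
def raagRels {V : Type*} (Γ : SimpleGraph V) : Set (FreeGroup V) :=
  {r | ∃ v w : V, Γ.Adj v w ∧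
    r = FreeGroup.of v * FreeGroup.of w * (FreeGroup.of v)⁻¹ * (FreeGroup.of w)⁻¹}

/-- The right-angled Artin group of a simple graph. -/
abbrev RAAG {V : Type*} (Γ : SimpleGraph V) : Type _ := PresentedGroup (raagRels Γ)

/-- The generator of `RAAG Γ` corresponding to a vertex. -/
def raagGen {V : Type*} (Γ : SimpleGraph V) (v : V) : RAAG Γ := PresentedGroup.of v

instance innerAutNormal (G : Type*) [Group G] :
    ((MulAut.conj : G →* MulAut G).range).Normal := by
  constructor
  intro x hx φ
  obtain ⟨g, rfl⟩ := hx
  refine ⟨φ g, ?_⟩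
  ext y
  simp [MulAut.conj]

abbrev OutG (G : Type*) [Group G] : Type _ :=
  MulAut G ⧸ ((MulAut.conj : G →* MulAut G).range)

def outMk (G : Type*) [Group G] : MulAut G →* OutG G :=
  QuotientGroup.mk' _

/-- `v` is a leaf: it has exactly one neighbor. -/
def IsLeaf {V : Type*} (Γ : SimpleGraph V) (v : V) : Prop :=
  (Γ.neighborSet v).ncard = 1

/-- The number of leaves. -/
noncomputable def numLeaves {V : Type*} (Γ : SimpleGraph V) : ℕ :=
  {v | IsLeaf Γ v}.ncard

/-- A subgraph has no separating vertex: deleting any of its vertices leaves it connected. -/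
def NoCutVertex {V : Type*} {Γ : SimpleGraph V} (H : Γ.Subgraph) : Prop :=
  ∀ v ∈ H.verts, (H.deleteVerts {v}).Connected

/-- A piece (block) of `Γ`: a maximal connected subgraph with at least one edge
having no separating vertex (a single edge counts as a piece). -/
def IsPiece {V : Type*} (Γ : SimpleGraph V) (H : Γ.Subgraph) : Prop :=
  H.Connected ∧ H.edgeSet.Nonempty ∧ NoCutVertex H ∧
    ∀ H' : Γ.Subgraph, H'.Connected → H'.edgeSet.Nonempty → NoCutVertex H' →
      H ≤ H' → H' = H

/-- The number of pieces of `Γ`. -/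
noncomputable def numPieces {V : Type*} (Γ : SimpleGraph V) : ℕ :=
  Nat.card {H : Γ.Subgraph // IsPiece Γ H}

/-- `u` and `w` are connected by a walk in `Γ` avoiding the vertex `v`
(i.e. they lie in the same connected component of `Γ ∖ {v}`). -/
def ReachAvoid {V : Type*} (Γ : SimpleGraph V) (v u w : V) : Prop :=
  ∃ p : Γ.Walk u w, v ∉ p.support

/-- There is an injective homomorphism from the free abelian group of rank `r` into `G`. -/
def HasFreeAbelianSubgroupOfRank (G : Type*) [Group G] (r : ℕ) : Prop :=
  ∃ f : Multiplicative (Fin r →₀ ℤ) →* G, Function.Injective f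

section Presentation

variable {V : Type*} {Γ : SimpleGraph V}

lemma commute_raagGen {v w : V} (h : Γ.Adj v w) : Commute (raagGen Γ v) (raagGen Γ w) := by
  have : PresentedGroup.mk (raagRels Γ) (FreeGroup.of v * FreeGroup.of w *
      (FreeGroup.of v)⁻¹ * (FreeGroup.of w)⁻¹) = 1 :=
    PresentedGroup.one_of_mem ⟨v, w, h, rfl⟩
  simp only [map_mul, map_inv] at this
  rw [mul_inv_eq_one, mul_inv_eq_iff_eq_mul] at this
  exact this

lemma raagHom_ext {G : Type*} [Monoid G] {φ ψ : RAAG Γ →* G}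
    (h : ∀ v, φ (raagGen Γ v) = ψ (raagGen Γ v)) : φ = ψ := by
  refine MonoidHom.eq_of_eqOn_dense (PresentedGroup.closure_range_of _) ?_
  rintro _ ⟨v, rfl⟩
  exact h v

/-- The homomorphism out of a right-angled Artin group determined by images of the generators. -/
def raagLift {G : Type*} [Group G] (f : V → G)
    (hf : ∀ v w, Γ.Adj v w → Commute (f v) (f w)) : RAAG Γ →* G :=
  PresentedGroup.toGroup (f := f) (by
    rintro _ ⟨v, w, h, rfl⟩
    simp [(hf v w h).eq])

@[simp]
lemma raagLift_raagGen {G : Type*} [Group G] (f : V → G)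
    (hf : ∀ v w, Γ.Adj v w → Commute (f v) (f w)) (v : V) :
    raagLift f hf (raagGen Γ v) = f v :=
  PresentedGroup.toGroup.of _

end Presentation

/-- A one-parameter group of endomorphisms is a one-parameter group of automorphisms. -/
def mulAutOfOneParameter {G : Type*} [Group G] (F : ℤ → G →* G) (zero : F 0 = MonoidHom.id G)
    (add : ∀ m n, F (m + n) = (F m).comp (F n)) : Multiplicative ℤ →* MulAut G where
  toFun m := MonoidHom.toMulEquiv (F m.toAdd) (F (-m.toAdd))
    (by rw [← add, neg_add_cancel, zero]) (by rw [← add, add_neg_cancel, zero])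
  map_one' := by
    ext g
    exact DFunLike.congr_fun zero g
  map_mul' m n := by
    ext g
    exact DFunLike.congr_fun (add m.toAdd n.toAdd) g

/-- Data of an automorphism `z ↦ q ^ left * z * q ^ right` for `z ∈ support`, where
`q = multiplier`, fixing the other generators. -/
structure Twist {V : Type*} (Γ : SimpleGraph V) where
  support : Set V
  multiplier : V
  left : ℤ
  right : ℤ
  multiplier_notMem : multiplier ∉ support
  boundary : ∀ z ∈ support, ∀ w ∉ support, Γ.Adj z w → multiplier = w ∨ Γ.Adj multiplier w
  interior : ∀ z ∈ support, ∀ w ∈ support, Γ.Adj z w → left + right = 0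

namespace Twist

variable {V : Type*} {Γ : SimpleGraph V}

open Classical in
/-- The image of a generator under the `m`-th power of a twist. -/
noncomputable def genImage (D : Twist Γ) (m : ℤ) (z : V) : RAAG Γ :=
  if z ∈ D.support then
    raagGen Γ D.multiplier ^ (D.left * m) * raagGen Γ z * raagGen Γ D.multiplier ^ (D.right * m)
  else raagGen Γ z

lemma genImage_of_mem {D : Twist Γ} {z : V} (hz : z ∈ D.support) (m : ℤ) :
    D.genImage m z = raagGen Γ D.multiplier ^ (D.left * m) * raagGen Γ z *
      raagGen Γ D.multiplier ^ (D.right * m) :=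
  if_pos hz

lemma genImage_of_notMem {D : Twist Γ} {z : V} (hz : z ∉ D.support) (m : ℤ) :
    D.genImage m z = raagGen Γ z :=
  if_neg hz

lemma commute_genImage_of_mem_of_notMem (D : Twist Γ) (m : ℤ) {z w : V} (h : Γ.Adj z w)
    (hz : z ∈ D.support) (hw : w ∉ D.support) :
    Commute (D.genImage m z) (D.genImage m w) := by
  rw [genImage_of_mem hz, genImage_of_notMem hw]
  have hq : Commute (raagGen Γ D.multiplier) (raagGen Γ w) := by
    rcases D.boundary z hz w hw h with rfl | h'
    · exact Commute.refl _
    · exact commute_raagGen h'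
  exact ((hq.zpow_left _).mul_left (commute_raagGen h)).mul_left (hq.zpow_left _)

lemma commute_genImage (D : Twist Γ) (m : ℤ) {z w : V} (h : Γ.Adj z w) :
    Commute (D.genImage m z) (D.genImage m w) := by
  by_cases hz : z ∈ D.support <;> by_cases hw : w ∈ D.support
  · have hlr : D.right * m = -(D.left * m) := by
      rw [← neg_mul, eq_neg_of_add_eq_zero_right (D.interior z hz w hw h)]
    rw [genImage_of_mem hz, genImage_of_mem hw, hlr, zpow_neg, Commute.conj_iff]
    exact commute_raagGen h
  · exact D.commute_genImage_of_mem_of_notMem m h hz hw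
  · exact (D.commute_genImage_of_mem_of_notMem m h.symm hw hz).symm
  · rw [genImage_of_notMem hz, genImage_of_notMem hw]
    exact commute_raagGen h

/-- The `m`-th power of a twist, as an endomorphism. -/
noncomputable def toHom (D : Twist Γ) (m : ℤ) : RAAG Γ →* RAAG Γ :=
  raagLift (D.genImage m) fun _ _ h ↦ D.commute_genImage m h

lemma toHom_of_mem {D : Twist Γ} {z : V} (hz : z ∈ D.support) (m : ℤ) :
    D.toHom m (raagGen Γ z) = raagGen Γ D.multiplier ^ (D.left * m) * raagGen Γ z *
      raagGen Γ D.multiplier ^ (D.right * m) := by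
  rw [toHom, raagLift_raagGen, genImage_of_mem hz]

lemma toHom_of_notMem {D : Twist Γ} {z : V} (hz : z ∉ D.support) (m : ℤ) :
    D.toHom m (raagGen Γ z) = raagGen Γ z := by
  rw [toHom, raagLift_raagGen, genImage_of_notMem hz]

lemma toHom_zero (D : Twist Γ) : D.toHom 0 = MonoidHom.id _ := by
  refine raagHom_ext fun z ↦ ?_
  by_cases hz : z ∈ D.support
  · simp [toHom_of_mem hz]
  · simp [toHom_of_notMem hz]

lemma toHom_add (D : Twist Γ) (m n : ℤ) : D.toHom (m + n) = (D.toHom m).comp (D.toHom n) := by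
  refine raagHom_ext fun z ↦ ?_
  by_cases hz : z ∈ D.support
  · simp only [MonoidHom.comp_apply, toHom_of_mem hz, map_mul, map_zpow,
      toHom_of_notMem D.multiplier_notMem, mul_add]
    rw [add_comm (D.left * m), zpow_add, zpow_add]
    simp only [mul_assoc]
  · simp [toHom_of_notMem hz]

/-- The one-parameter group of automorphisms generated by a twist. -/
noncomputable def toMulAut (D : Twist Γ) : Multiplicative ℤ →* MulAut (RAAG Γ) :=
  mulAutOfOneParameter D.toHom D.toHom_zero D.toHom_add

lemma toMulAut_of_mem {D : Twist Γ} {z : V} (hz : z ∈ D.support) (m : Multiplicative ℤ) :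
    D.toMulAut m (raagGen Γ z) = raagGen Γ D.multiplier ^ (D.left * m.toAdd) * raagGen Γ z *
      raagGen Γ D.multiplier ^ (D.right * m.toAdd) :=
  toHom_of_mem hz _

lemma toMulAut_of_notMem {D : Twist Γ} {z : V} (hz : z ∉ D.support) (m : Multiplicative ℤ) :
    D.toMulAut m (raagGen Γ z) = raagGen Γ z :=
  toHom_of_notMem hz _

/-- A homomorphism to a commutative group does not see a twist whose multiplier it kills. -/
lemma map_toMulAut {A : Type*} [CommGroup A] (D : Twist Γ) (h : RAAG Γ →* A) {z : V}
    (hz : z ∈ D.support → D.left + D.right = 0 ∨ h (raagGen Γ D.multiplier) = 1)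
    (m : Multiplicative ℤ) : h (D.toMulAut m (raagGen Γ z)) = h (raagGen Γ z) := by
  by_cases hm : z ∈ D.support
  · rw [toMulAut_of_mem hm, map_mul, map_mul, mul_right_comm, map_zpow, map_zpow, ← zpow_add,
      ← add_mul]
    rcases hz hm with h0 | h1
    · simp [h0]
    · simp [h1]
  · rw [toMulAut_of_notMem hm]

lemma commute_toMulAut_iff {D E : Twist Γ} {m n : Multiplicative ℤ} :
    Commute (D.toMulAut m) (E.toMulAut n) ↔ ∀ z, D.toMulAut m (E.toMulAut n (raagGen Γ z)) =
      E.toMulAut n (D.toMulAut m (raagGen Γ z)) := by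
  refine ⟨fun h z ↦ DFunLike.congr_fun h.eq (raagGen Γ z), fun h ↦ ?_⟩
  have := raagHom_ext (φ := (D.toMulAut m * E.toMulAut n).toMonoidHom)
    (ψ := (E.toMulAut n * D.toMulAut m).toMonoidHom) h
  exact MulEquiv.ext fun g ↦ DFunLike.congr_fun this g

/-- Twists whose supports avoid each other's multipliers commute when the supports are disjoint
or the multipliers commute. -/
lemma commute_of_multipliers_notMem {D E : Twist Γ} (hD : D.multiplier ∉ E.support)
    (hE : E.multiplier ∉ D.support)
    (h : ∀ z ∈ D.support, z ∈ E.support →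
      Commute (raagGen Γ D.multiplier) (raagGen Γ E.multiplier)) (m n : Multiplicative ℤ) :
    Commute (D.toMulAut m) (E.toMulAut n) := by
  rw [commute_toMulAut_iff]
  intro z
  by_cases hzD : z ∈ D.support <;> by_cases hzE : z ∈ E.support
  · simp only [toMulAut_of_mem hzD, toMulAut_of_mem hzE, map_mul, map_zpow,
      toMulAut_of_notMem hD, toMulAut_of_notMem hE]
    have hc := h z hzD hzE
    simp only [mul_assoc]
    rw [(hc.zpow_zpow (D.right * m.toAdd) (E.right * n.toAdd)).eq]
    rw [← mul_assoc, ← mul_assoc, ← (hc.zpow_zpow (D.left * m.toAdd) (E.left * n.toAdd)).eq]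
    simp only [mul_assoc]
  · simp [toMulAut_of_mem hzD, toMulAut_of_notMem hzE, toMulAut_of_notMem hD]
  · simp [toMulAut_of_notMem hzD, toMulAut_of_mem hzE, toMulAut_of_notMem hE]
  · simp [toMulAut_of_notMem hzD, toMulAut_of_notMem hzE]

/-- A partial conjugation commutes with the twists living inside its support. -/
lemma commute_of_subset {D E : Twist Γ} (hlr : D.left + D.right = 0)
    (hsub : E.support ⊆ D.support) (hE : E.multiplier ∈ D.support) (m n : Multiplicative ℤ) :
    Commute (D.toMulAut m) (E.toMulAut n) := by
  have hD : D.multiplier ∉ E.support := fun h ↦ D.multiplier_notMem (hsub h)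
  have hlr' : D.right * m.toAdd = -(D.left * m.toAdd) := by
    rw [← neg_mul, eq_neg_of_add_eq_zero_right hlr]
  rw [commute_toMulAut_iff]
  intro z
  by_cases hzE : z ∈ E.support
  · simp only [toMulAut_of_mem (hsub hzE), toMulAut_of_mem hzE, map_mul, map_zpow,
      toMulAut_of_notMem hD, toMulAut_of_mem hE, hlr', zpow_neg, map_inv,
      conj_zpow]
    group
  · by_cases hzD : z ∈ D.support
    · simp [toMulAut_of_mem hzD, toMulAut_of_notMem hzE, toMulAut_of_notMem hD]
    · simp [toMulAut_of_notMem hzD, toMulAut_of_notMem hzE]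

end Twist

/-- A parent map realises the edges of `Γ` as the pairs `{z, p z}`; none of its cycles has
length at most three. -/
structure IsParentMap {V : Type*} (Γ : SimpleGraph V) (p : V → V) : Prop where
  adj_iff : ∀ z w, Γ.Adj z w ↔ p z = w ∨ p w = z
  apply_ne : ∀ z, p z ≠ z
  apply_apply_ne : ∀ z, p (p z) ≠ z
  apply_apply_apply_ne : ∀ z, p (p (p z)) ≠ z

/-- The vertices reaching `x` under iteration of `p`. -/
def descendants {V : Type*} (p : V → V) (x : V) : Set V := {z | ∃ n, p^[n] z = x}

section Descendants

variable {V : Type*} {p : V → V} {x y z : V}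

lemma self_mem_descendants : x ∈ descendants p x := ⟨0, rfl⟩

lemma mem_descendants_of_apply_mem (h : p z ∈ descendants p x) : z ∈ descendants p x := by
  obtain ⟨n, hn⟩ := h
  exact ⟨n + 1, hn⟩

lemma eq_or_apply_mem_descendants (h : z ∈ descendants p x) :
    z = x ∨ p z ∈ descendants p x := by
  obtain ⟨_ | n, hn⟩ := h
  · exact Or.inl hn
  · exact Or.inr ⟨n, hn⟩

lemma descendants_subset (h : y ∈ descendants p x) : descendants p y ⊆ descendants p x := by
  rintro z ⟨m, rfl⟩
  obtain ⟨n, rfl⟩ := h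
  exact ⟨n + m, Function.iterate_add_apply p n m z⟩

lemma mem_descendants_or_mem_descendants (hx : z ∈ descendants p x) (hy : z ∈ descendants p y) :
    x ∈ descendants p y ∨ y ∈ descendants p x := by
  obtain ⟨m, rfl⟩ := hx
  obtain ⟨n, rfl⟩ := hy
  rcases le_total m n with h | h
  · exact Or.inl ⟨n - m, by rw [← Function.iterate_add_apply, Nat.sub_add_cancel h]⟩
  · exact Or.inr ⟨m - n, by rw [← Function.iterate_add_apply, Nat.sub_add_cancel h]⟩

lemma iterate_notMem_descendants (hx : ∀ n, 0 < n → p^[n] x ≠ x) {n : ℕ} (hn : 0 < n) :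
    p^[n] x ∉ descendants p x := by
  rintro ⟨m, hm⟩
  rw [← Function.iterate_add_apply] at hm
  exact hx _ (by lia) hm

lemma eq_of_mem_descendants_of_mem_descendants (hx : ∀ n, 0 < n → p^[n] x ≠ x)
    (hxy : x ∈ descendants p y) (hyx : y ∈ descendants p x) : x = y := by
  obtain ⟨_ | n, rfl⟩ := hxy
  · rfl
  · exact absurd hyx (iterate_notMem_descendants hx n.succ_pos)

end Descendants

namespace IsParentMap

variable {V : Type*} {Γ : SimpleGraph V} {p : V → V}

lemma adj_apply (hp : IsParentMap Γ p) (z : V) : Γ.Adj z (p z) :=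
  (hp.adj_iff _ _).2 (Or.inl rfl)

lemma apply_ne_of_isLeaf (hp : IsParentMap Γ p) {v : V} (hv : IsLeaf Γ v) (z : V) : p z ≠ v := by
  rintro rfl
  obtain ⟨a, ha⟩ := Set.ncard_eq_one.1 hv
  have h1 : z ∈ Γ.neighborSet (p z) := (hp.adj_apply z).symm
  have h2 : p (p z) ∈ Γ.neighborSet (p z) := hp.adj_apply (p z)
  rw [ha] at h1 h2
  exact hp.apply_apply_ne z (h2.trans h1.symm)

/-- Conjugation of the descendants of a non-periodic vertex by the grandparent of that vertex. -/
def conjTwist (hp : IsParentMap Γ p) (x : V) (hx : ∀ n, 0 < n → p^[n] x ≠ x) : Twist Γ where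
  support := descendants p x
  multiplier := p (p x)
  left := 1
  right := -1
  multiplier_notMem := iterate_notMem_descendants hx (n := 2) two_pos
  boundary := by
    intro z hz w hw h
    rcases (hp.adj_iff z w).1 h with rfl | rfl
    · rcases eq_or_apply_mem_descendants hz with rfl | h'
      · exact Or.inr (hp.adj_apply _).symm
      · exact absurd h' hw
    · exact absurd (mem_descendants_of_apply_mem hz) hw
  interior _ _ _ _ _ := rfl

/-- The multiplier of a leaf transvection: the parent or the grandparent of the leaf. -/
def ancestor (p : V → V) (v : V) (b : Bool) : V := bif b then p v else p (p v)

lemma ancestor_ne_of_isLeaf (hp : IsParentMap Γ p) {v : V} (hv : IsLeaf Γ v) (w : V) (b : Bool) :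
    ancestor p w b ≠ v := by
  cases b <;> exact hp.apply_ne_of_isLeaf hv _

/-- Right multiplication of a leaf by its parent or its grandparent. -/
def leafTwist (hp : IsParentMap Γ p) (v : V) (hv : IsLeaf Γ v) (b : Bool) : Twist Γ where
  support := {v}
  multiplier := ancestor p v b
  left := 0
  right := 1
  multiplier_notMem := hp.ancestor_ne_of_isLeaf hv v b
  boundary := by
    rintro z rfl w - h
    rcases (hp.adj_iff z w).1 h with rfl | h'
    · cases b
      · exact Or.inr (hp.adj_apply _).symm
      · exact Or.inl rfl
    · exact absurd h' (hp.apply_ne_of_isLeaf hv w)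
  interior := by
    rintro z rfl w rfl h
    exact absurd h (Γ.irrefl)

lemma commute_conjTwist (hp : IsParentMap Γ p) {x y : V} (hx : ∀ n, 0 < n → p^[n] x ≠ x)
    (hy : ∀ n, 0 < n → p^[n] y ≠ y) (hxy : x ≠ y) (m n : Multiplicative ℤ) :
    Commute ((hp.conjTwist x hx).toMulAut m) ((hp.conjTwist y hy).toMulAut n) := by
  wlog h : x ∉ descendants p y generalizing x y m n
  · push Not at h
    refine (this hy hx hxy.symm n m fun h' ↦ hxy ?_).symm
    exact eq_of_mem_descendants_of_mem_descendants hx h h'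
  have hDE : (hp.conjTwist x hx).multiplier ∉ (hp.conjTwist y hy).support := fun h' ↦
    h (mem_descendants_of_apply_mem (mem_descendants_of_apply_mem h'))
  by_cases hyx : y ∈ descendants p x
  · by_cases hq : p (p y) ∈ descendants p x
    · exact Twist.commute_of_subset rfl (descendants_subset hyx) hq m n
    · refine Twist.commute_of_multipliers_notMem hDE hq (fun _ _ _ ↦ ?_) m n
      have h1 := (eq_or_apply_mem_descendants hyx).resolve_left hxy.symm
      have h2 := (eq_or_apply_mem_descendants h1).resolve_right hq
      change Commute (raagGen Γ (p (p x))) (raagGen Γ (p (p y)))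
      rw [h2]
      exact commute_raagGen (hp.adj_apply _).symm
  · refine Twist.commute_of_multipliers_notMem hDE (fun h' ↦ hyx ?_) (fun z hzx hzy ↦ ?_) m n
    · exact mem_descendants_of_apply_mem (mem_descendants_of_apply_mem h')
    · exact ((mem_descendants_or_mem_descendants hzx hzy).elim h hyx).elim

lemma commute_conjTwist_leafTwist (hp : IsParentMap Γ p) {x v : V}
    (hx : ∀ n, 0 < n → p^[n] x ≠ x) (hv : IsLeaf Γ v) (b : Bool) (m n : Multiplicative ℤ) :
    Commute ((hp.conjTwist x hx).toMulAut m) ((hp.leafTwist v hv b).toMulAut n) := by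
  have hDE : (hp.conjTwist x hx).multiplier ∉ (hp.leafTwist v hv b).support :=
    hp.apply_ne_of_isLeaf hv _
  by_cases hq : ancestor p v b ∈ descendants p x
  · have hvx : v ∈ descendants p x := by
      cases b
      · exact mem_descendants_of_apply_mem (mem_descendants_of_apply_mem hq)
      · exact mem_descendants_of_apply_mem hq
    exact Twist.commute_of_subset rfl (Set.singleton_subset_iff.2 hvx) hq m n
  · refine Twist.commute_of_multipliers_notMem hDE hq ?_ m n
    intro z hzx hzv
    replace hzx : v ∈ descendants p x := (show z = v from hzv) ▸ hzx
    change Commute (raagGen Γ (p (p x))) (raagGen Γ (ancestor p v b))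
    rcases eq_or_apply_mem_descendants hzx with rfl | h1
    · cases b
      · exact Commute.refl _
      · exact commute_raagGen (hp.adj_apply _).symm
    · cases b
      · have h2 : p v = x := (eq_or_apply_mem_descendants h1).resolve_right hq
        rw [ancestor, cond_false, h2]
        exact commute_raagGen (hp.adj_apply _).symm
      · exact absurd h1 hq

lemma commute_leafTwist (hp : IsParentMap Γ p) {v w : V} (hv : IsLeaf Γ v) (hw : IsLeaf Γ w)
    (b c : Bool) (m n : Multiplicative ℤ) :
    Commute ((hp.leafTwist v hv b).toMulAut m) ((hp.leafTwist w hw c).toMulAut n) := by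
  refine Twist.commute_of_multipliers_notMem (D := hp.leafTwist v hv b)
    (E := hp.leafTwist w hw c) (hp.ancestor_ne_of_isLeaf hw v b)
    (hp.ancestor_ne_of_isLeaf hv w c) (fun z hzv hzw ↦ ?_) m n
  obtain rfl : v = w := (show z = v from hzv).symm.trans hzw
  change Commute (raagGen Γ (ancestor p v b)) (raagGen Γ (ancestor p v c))
  cases b <;> cases c
  · exact Commute.refl _
  · exact commute_raagGen (hp.adj_apply _).symm
  · exact commute_raagGen (hp.adj_apply _)
  · exact Commute.refl _

/-- Index type of the commuting family of twists: a conjugation for each non-periodic vertex and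
two transvections for each leaf. -/
abbrev TwistIndex (Γ : SimpleGraph V) (p : V → V) : Type _ :=
  {x : V // ∀ n, 0 < n → p^[n] x ≠ x} ⊕ {v : V // IsLeaf Γ v} × Bool

/-- The commuting family of twists attached to a parent map. -/
def twist (hp : IsParentMap Γ p) : TwistIndex Γ p → Twist Γ
  | .inl x => hp.conjTwist x.1 x.2
  | .inr v => hp.leafTwist v.1.1 v.1.2 v.2

lemma commute_twist (hp : IsParentMap Γ p) : Pairwise fun i j : TwistIndex Γ p ↦
    ∀ m n, Commute ((hp.twist i).toMulAut m) ((hp.twist j).toMulAut n) := by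
  rintro (⟨x, hx⟩ | ⟨⟨v, hv⟩, b⟩) (⟨y, hy⟩ | ⟨⟨w, hw⟩, c⟩) hij m n
  · exact hp.commute_conjTwist hx hy (fun h ↦ hij (by subst h; rfl)) m n
  · exact hp.commute_conjTwist_leafTwist hx hw c m n
  · exact (hp.commute_conjTwist_leafTwist hy hv b n m).symm
  · exact hp.commute_leafTwist hv hw b c m n

/-- The homomorphism to `ℤ` counting occurrences of the generator `q`. -/
noncomputable def _root_.raagCount (Γ : SimpleGraph V) (q : V) : RAAG Γ →* Multiplicative ℤ :=
  open Classical in raagLift (fun z ↦ if z = q then Multiplicative.ofAdd 1 else 1)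
    fun _ _ _ ↦ Commute.all _ _

open ModularGroup in
/-- The homomorphism to `SL(2, ℤ)` sending the grandparent of `x` to `T`, and both `x` and the
grandparent of that grandparent to `S`. -/
noncomputable def detect (hp : IsParentMap Γ p) (x : V) :
    RAAG Γ →* Matrix.SpecialLinearGroup (Fin 2) ℤ :=
  open Classical in
  raagLift (fun z ↦ if z = p (p x) then T else if z = x ∨ z = p (p (p (p x))) then S else 1) (by
    intro z w h
    have hc : ∀ z, Γ.Adj (p (p x)) z → ¬ (z = x ∨ z = p (p (p (p x)))) := by
      rintro z h (rfl | rfl) <;> rw [hp.adj_iff] at h <;> rcases h with h | h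
      · exact hp.apply_apply_apply_ne _ h
      · exact hp.apply_ne _ h.symm
      · exact hp.apply_ne _ h.symm
      · exact hp.apply_apply_apply_ne _ h
    by_cases hz : z = p (p x)
    · have hw : w ≠ p (p x) := fun hw ↦ h.ne (hz.trans hw.symm)
      rw [if_neg hw, if_neg (hc w (hz ▸ h))]
      exact Commute.one_right _
    · by_cases hw : w = p (p x)
      · rw [if_neg hz, if_neg (hc z (hw ▸ h.symm))]
        exact Commute.one_left _
      · rw [if_neg hz, if_neg hw]
        split_ifs <;> simp)

lemma detect_grandparent (hp : IsParentMap Γ p) (x : V) :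
    hp.detect x (raagGen Γ (p (p x))) = ModularGroup.T := by
  simp [detect]

lemma detect_self (hp : IsParentMap Γ p) (x : V) :
    hp.detect x (raagGen Γ x) = ModularGroup.S := by
  simp [detect, (hp.apply_apply_ne x).symm]

lemma detect_fourth (hp : IsParentMap Γ p) (x : V) :
    hp.detect x (raagGen Γ (p (p (p (p x))))) = ModularGroup.S := by
  simp [detect, hp.apply_apply_ne]

lemma _root_.ModularGroup.eq_zero_of_conj_T_zpow {n : ℤ}
    (h : ModularGroup.T ^ n * ModularGroup.S * (ModularGroup.T ^ n)⁻¹ = ModularGroup.S) :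
    n = 0 := by
  rw [mul_inv_eq_iff_eq_mul] at h
  have := congrArg
    (fun A : Matrix.SpecialLinearGroup (Fin 2) ℤ ↦ (A : Matrix (Fin 2) (Fin 2) ℤ) 0 0) h
  simpa [ModularGroup.coe_T_zpow, ModularGroup.coe_S, Matrix.mul_apply, Fin.sum_univ_two]
    using this

variable [Fintype (TwistIndex Γ p)]

/-- The automorphisms of the right-angled Artin group generated by the commuting twists. -/
noncomputable def twistHom (hp : IsParentMap Γ p) :
    (TwistIndex Γ p → Multiplicative ℤ) →* MulAut (RAAG Γ) :=
  MonoidHom.noncommPiCoprod (fun i ↦ (hp.twist i).toMulAut) hp.commute_twist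

lemma twistHom_induction (hp : IsParentMap Γ p) (f : TwistIndex Γ p → Multiplicative ℤ)
    (P : MulAut (RAAG Γ) → Prop) (mul : ∀ φ ψ, P φ → P ψ → P (φ * ψ)) (one : P 1)
    (base : ∀ i, P ((hp.twist i).toMulAut (f i))) : P (hp.twistHom f) := by
  rw [twistHom, MonoidHom.noncommPiCoprod_apply]
  exact Finset.noncommProd_induction _ _ _ P mul one fun i _ ↦ base i

lemma exists_twistHom_eq_mul (hp : IsParentMap Γ p) (f : TwistIndex Γ p → Multiplicative ℤ)
    (i : TwistIndex Γ p) (P : MulAut (RAAG Γ) → Prop)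
    (mul : ∀ φ ψ, P φ → P ψ → P (φ * ψ)) (one : P 1)
    (base : ∀ j ≠ i, P ((hp.twist j).toMulAut (f j))) :
    ∃ φ, P φ ∧ hp.twistHom f = (hp.twist i).toMulAut (f i) * φ := by
  classical
  have h : hp.twistHom f =
      (hp.twist i).toMulAut (f i) * hp.twistHom (Function.update f i 1) := by
    have hf : f = Pi.mulSingle i (f i) * Function.update f i 1 := by
      ext j
      rcases eq_or_ne j i with rfl | hj <;> simp [*]
    conv_lhs => rw [hf, map_mul]
    rw [twistHom, MonoidHom.noncommPiCoprod_mulSingle]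
  refine ⟨_, hp.twistHom_induction _ P mul one fun j ↦ ?_, h⟩
  rcases eq_or_ne j i with rfl | hj
  · simpa using one
  · simpa [hj] using base j hj

lemma leaf_exponent_eq_one (hp : IsParentMap Γ p) {f : TwistIndex Γ p → Multiplicative ℤ}
    {g : RAAG Γ} (hf : hp.twistHom f = MulAut.conj g) (v : {v : V // IsLeaf Γ v}) (b : Bool) :
    f (.inr (v, b)) = 1 := by
  obtain ⟨φ, hφ, h⟩ := hp.exists_twistHom_eq_mul f (.inr (v, b))
    (fun φ ↦ ∀ h : RAAG Γ →* Multiplicative ℤ, h (raagGen Γ (ancestor p v (!b))) = 1 →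
      h (φ (raagGen Γ (ancestor p v (!b)))) = 1 ∧ h (φ (raagGen Γ v)) = h (raagGen Γ v))
    (fun φ ψ hφ hψ h hh ↦
      ⟨(hψ (h.comp φ.toMonoidHom) (hφ h hh).1).1,
        ((hψ (h.comp φ.toMonoidHom) (hφ h hh).1).2).trans (hφ h hh).2⟩)
    (fun h hh ↦ ⟨hh, rfl⟩) (by
      rintro (⟨x, hx⟩ | ⟨w, c⟩) hj h hh
      · exact ⟨(Twist.map_toMulAut _ h (fun _ ↦ Or.inl rfl) _).trans hh,
          Twist.map_toMulAut _ h (fun _ ↦ Or.inl rfl) _⟩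
      · refine ⟨(Twist.map_toMulAut _ h (fun h' ↦ ?_) _).trans hh,
          Twist.map_toMulAut _ h (fun h' ↦ Or.inr ?_) _⟩
        · exact absurd h' (hp.ancestor_ne_of_isLeaf w.2 _ _)
        · obtain rfl : v = w := Subtype.ext h'
          have hc : c = !b := by
            cases b <;> cases c <;> simp_all
          subst hc
          exact hh)
  have hne : p v ≠ p (p v) := (hp.apply_ne (p v)).symm
  set χ := raagCount Γ (ancestor p v b) with hχ
  have h0 : χ (raagGen Γ (ancestor p v (!b))) = 1 := by
    cases b <;> simp [hχ, raagCount, ancestor, hne, hne.symm]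
  have h1 : χ (raagGen Γ (ancestor p v b)) = Multiplicative.ofAdd 1 := by
    simp [hχ, raagCount]
  have hleaf : χ ((hp.twist (.inr (v, b))).toMulAut (f (.inr (v, b))) (raagGen Γ v)) =
      χ (raagGen Γ v) * Multiplicative.ofAdd 1 ^ (f (.inr (v, b))).toAdd := by
    rw [Twist.toMulAut_of_mem (show (v : V) ∈ (hp.twist (.inr (v, b))).support from rfl), ← h1]
    simp [twist, leafTwist]
  have hanc : χ ((hp.twist (.inr (v, b))).toMulAut (f (.inr (v, b)))
      (raagGen Γ (ancestor p v (!b)))) = 1 := by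
    rw [Twist.toMulAut_of_notMem (hp.ancestor_ne_of_isLeaf v.2 _ _), h0]
  have hconj : χ (hp.twistHom f (raagGen Γ v)) = χ (raagGen Γ v) := by
    rw [hf, MulAut.conj_apply, map_mul, map_mul, map_inv, mul_inv_cancel_comm]
  rw [h] at hconj
  have := ((hφ (χ.comp ((hp.twist (.inr (v, b))).toMulAut (f (.inr (v, b)))).toMonoidHom)
    hanc).2.symm.trans hconj)
  have := hleaf.symm.trans this
  rw [mul_eq_left] at this
  simpa [← ofAdd_zsmul] using this

lemma conj_exponent_eq_one [Finite V] (hp : IsParentMap Γ p)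
    {f : TwistIndex Γ p → Multiplicative ℤ}
    {g : RAAG Γ} (hf : hp.twistHom f = MulAut.conj g) (i) : f (.inl i) = 1 := by
  by_contra hi
  obtain ⟨⟨x, hx⟩, hfx, hmax⟩ := Set.exists_max_image {i | f (.inl i) ≠ 1}
    (fun i ↦ (descendants p i.1).ncard) (Set.toFinite _) ⟨i, hi⟩
  have hproper : ∀ y, f (.inl y) ≠ 1 → x ∈ descendants p y.1 → y.1 = x := by
    intro y hy hxy
    by_contra hne
    have hyx : y.1 ∉ descendants p x := fun h ↦
      hne (eq_of_mem_descendants_of_mem_descendants hx hxy h).symm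
    exact (hmax y hy).not_gt (Set.ncard_lt_ncard
      ⟨descendants_subset hxy, fun h ↦ hyx (h self_mem_descendants)⟩)
  have hmul (z : V) (φ ψ : MulAut (RAAG Γ)) (hφ : φ (raagGen Γ z) = raagGen Γ z)
      (hψ : ψ (raagGen Γ z) = raagGen Γ z) : (φ * ψ) (raagGen Γ z) = raagGen Γ z := by
    rw [MulAut.mul_apply, hψ, hφ]
  have hfix : hp.twistHom f (raagGen Γ (p (p (p (p x))))) = raagGen Γ (p (p (p (p x)))) := by
    refine hp.twistHom_induction f _ (hmul _) rfl ?_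
    rintro (y | ⟨v, b⟩)
    · by_cases hy : f (.inl y) = 1
      · rw [hy, map_one, MulAut.one_apply]
      · refine Twist.toMulAut_of_notMem (fun h ↦ ?_) _
        have hxy : x ∈ descendants p y.1 := descendants_subset h ⟨4, rfl⟩
        obtain rfl := hproper y hy hxy
        exact iterate_notMem_descendants hx (n := 4) four_pos h
    · rw [hp.leaf_exponent_eq_one hf, map_one, MulAut.one_apply]
  obtain ⟨φ, hφ, h⟩ := hp.exists_twistHom_eq_mul f (.inl ⟨x, hx⟩) _ (hmul x) rfl (by
    rintro (y | ⟨v, b⟩) hj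
    · by_cases hy : f (.inl y) = 1
      · rw [hy, map_one, MulAut.one_apply]
      · refine Twist.toMulAut_of_notMem (fun h ↦ hj ?_) _
        exact congrArg Sum.inl (Subtype.ext (hproper y hy h))
    · rw [hp.leaf_exponent_eq_one hf, map_one, MulAut.one_apply])
  have hx' : hp.twistHom f (raagGen Γ x) =
      raagGen Γ (p (p x)) ^ (f (.inl ⟨x, hx⟩)).toAdd * raagGen Γ x *
        (raagGen Γ (p (p x)) ^ (f (.inl ⟨x, hx⟩)).toAdd)⁻¹ := by
    rw [h, MulAut.mul_apply, hφ, Twist.toMulAut_of_mem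
      (show x ∈ (hp.twist (.inl ⟨x, hx⟩)).support from self_mem_descendants)]
    simp [twist, conjTwist]
  rw [hf, MulAut.conj_apply] at hfix hx'
  have h4 := congrArg (hp.detect x) hfix
  have h1 := congrArg (hp.detect x) hx'
  simp only [map_mul, map_inv, map_zpow, detect_self, detect_fourth, detect_grandparent]
    at h1 h4
  refine hfx (Multiplicative.toAdd.injective ?_)
  exact ModularGroup.eq_zero_of_conj_T_zpow (h1.symm.trans h4)

lemma outMk_comp_twistHom_injective [Finite V] (hp : IsParentMap Γ p) :
    Function.Injective ((outMk (RAAG Γ)).comp hp.twistHom) := by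
  rw [injective_iff_map_eq_one]
  intro f hf
  obtain ⟨g, hg⟩ := (QuotientGroup.eq_one_iff _).1 hf
  funext i
  rcases i with x | ⟨v, b⟩
  · exact hp.conj_exponent_eq_one hg.symm x
  · exact hp.leaf_exponent_eq_one hg.symm v b

end IsParentMap

lemma hasFreeAbelianSubgroupOfRank_of_injective {G ι : Type*} [Group G] [Fintype ι]
    (F : (ι → Multiplicative ℤ) →* G) (hF : Function.Injective F) :
    HasFreeAbelianSubgroupOfRank G (Nat.card ι) := by
  let σ : ι ≃ Fin (Nat.card ι) := Finite.equivFin ι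
  let E : Multiplicative (Fin (Nat.card ι) →₀ ℤ) →* (ι → Multiplicative ℤ) :=
    { toFun := fun f i ↦ Multiplicative.ofAdd (f.toAdd (σ i))
      map_one' := rfl
      map_mul' := fun _ _ ↦ rfl }
  refine ⟨F.comp E, hF.comp fun f g h ↦ Multiplicative.toAdd.injective (Finsupp.ext fun j ↦ ?_)⟩
  have hj : f.toAdd (σ (σ.symm j)) = g.toAdd (σ (σ.symm j)) := congrFun h (σ.symm j)
  rwa [σ.apply_symm_apply] at hj

section CycleParent

variable {V : Type*} {Γ : SimpleGraph V}

lemma SimpleGraph.Walk.IsCycle.exists_zmod_param {v : V} {c : Γ.Walk v v} (hc : c.IsCycle) :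
    ∃ γ : ZMod c.length → V, Function.Injective γ ∧ ∀ i, Γ.Adj (γ i) (γ (i + 1)) := by
  have h3 := hc.three_le_length
  have : NeZero c.length := ⟨by lia⟩
  have : Fact (1 < c.length) := ⟨by lia⟩
  refine ⟨fun i ↦ c.getVert i.val, fun i j h ↦ ?_, fun i ↦ ?_⟩
  · refine ZMod.val_injective _ (hc.getVert_injOn' ?_ ?_ h)
    · have := i.val_lt
      rw [Set.mem_ofPred_eq]
      lia
    · have := j.val_lt
      rw [Set.mem_ofPred_eq]
      lia
  · have hlt := i.val_lt
    have hadj := c.adj_getVert_succ hlt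
    beta_reduce
    rw [ZMod.val_add, ZMod.val_one]
    rcases Nat.lt_or_ge (i.val + 1) c.length with h | h
    · rwa [Nat.mod_eq_of_lt h]
    · have heq : i.val + 1 = c.length := by lia
      rw [heq, c.getVert_length] at hadj
      rwa [heq, Nat.mod_self, c.getVert_zero]

lemma SimpleGraph.Connected.exists_adj_dist_lt (hconn : Γ.Connected) {z w : V} (h : z ≠ w) :
    ∃ u, Γ.Adj z u ∧ Γ.dist u w < Γ.dist z w := by
  obtain ⟨q, hq⟩ := hconn.exists_walk_length_eq_dist z w
  cases q with
  | nil => exact absurd rfl h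
  | cons hadj q =>
    refine ⟨_, hadj, ?_⟩
    rw [← hq, SimpleGraph.Walk.length_cons]
    exact Nat.lt_succ_of_le (SimpleGraph.dist_le q)

/-- A self-map rotating the cycle `γ` and moving every other vertex to a neighbor closer to it. -/
structure IsCycleRetraction (Γ : SimpleGraph V) {k : ℕ} (γ : ZMod k → V) (p : V → V) : Prop where
  apply_cycle : ∀ i, p (γ i) = γ (i + 1)
  adj : ∀ z, Γ.Adj z (p z)
  dist_lt : ∀ z ∉ Set.range γ, Γ.dist (p z) (γ 0) < Γ.dist z (γ 0)

lemma exists_isCycleRetraction (hconn : Γ.Connected) {k : ℕ} {γ : ZMod k → V}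
    (hinj : Function.Injective γ) (hadj : ∀ i, Γ.Adj (γ i) (γ (i + 1))) :
    ∃ p, IsCycleRetraction Γ γ p := by
  have (z : V) : ∃ w, (∀ i, z = γ i → w = γ (i + 1)) ∧ Γ.Adj z w ∧
      (z ∉ Set.range γ → Γ.dist w (γ 0) < Γ.dist z (γ 0)) := by
    by_cases hz : z ∈ Set.range γ
    · obtain ⟨i, rfl⟩ := hz
      exact ⟨γ (i + 1), fun j h ↦ by rw [hinj h], hadj i, fun h ↦ absurd ⟨i, rfl⟩ h⟩
    · obtain ⟨w, hw, hlt⟩ := hconn.exists_adj_dist_lt (z := z) (w := γ 0)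
        fun h ↦ hz ⟨0, h.symm⟩
      exact ⟨w, fun i h ↦ absurd ⟨i, h.symm⟩ hz, hw, fun _ ↦ hlt⟩
  choose p hcyc hp hlt using this
  exact ⟨p, fun i ↦ hcyc _ i rfl, hp, hlt⟩

namespace IsCycleRetraction

variable {k : ℕ} {γ : ZMod k → V} {p : V → V}

lemma iterate_cycle (hp : IsCycleRetraction Γ γ p) (n : ℕ) (i : ZMod k) :
    p^[n] (γ i) = γ (i + n) := by
  induction n with
  | zero => simp
  | succ n ih => rw [Function.iterate_succ_apply', ih, hp.apply_cycle, Nat.cast_succ, add_assoc]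

lemma iterate_mem_range_or_dist_lt (hp : IsCycleRetraction Γ γ p) (z : V) {n : ℕ} (hn : 0 < n) :
    p^[n] z ∈ Set.range γ ∨ Γ.dist (p^[n] z) (γ 0) < Γ.dist z (γ 0) := by
  induction n, Nat.succ_le_of_lt hn using Nat.le_induction with
  | base =>
    by_cases hz : z ∈ Set.range γ
    · obtain ⟨i, rfl⟩ := hz
      exact Or.inl ⟨i + 1, (hp.apply_cycle i).symm⟩
    · exact Or.inr (hp.dist_lt z hz)
  | succ n h ih =>
    rw [Function.iterate_succ_apply']
    by_cases hz : p^[n] z ∈ Set.range γ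
    · obtain ⟨i, hi⟩ := hz
      exact Or.inl ⟨i + 1, by rw [← hi, hp.apply_cycle]⟩
    · exact Or.inr ((hp.dist_lt _ hz).trans ((ih h).resolve_left hz))

lemma iterate_ne_of_notMem_range (hp : IsCycleRetraction Γ γ p) {z : V} (hz : z ∉ Set.range γ)
    {n : ℕ} (hn : 0 < n) : p^[n] z ≠ z := by
  intro h
  rcases hp.iterate_mem_range_or_dist_lt z hn with h' | h'
  · exact hz (h ▸ h')
  · exact (h ▸ h').false

lemma iterate_ne (hp : IsCycleRetraction Γ γ p) (hinj : Function.Injective γ) (z : V) {n : ℕ}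
    (hn : 0 < n) (hnk : n < k) : p^[n] z ≠ z := by
  by_cases hz : z ∈ Set.range γ
  · obtain ⟨i, rfl⟩ := hz
    rw [hp.iterate_cycle]
    intro h
    have h0 := hinj h
    rw [add_eq_left, ZMod.natCast_eq_zero_iff] at h0
    exact absurd (Nat.le_of_dvd hn h0) hnk.not_ge
  · exact hp.iterate_ne_of_notMem_range hz hn

lemma nonperiodic_iff (hp : IsCycleRetraction Γ γ p) (hk : 0 < k) (z : V) :
    (∀ n, 0 < n → p^[n] z ≠ z) ↔ z ∉ Set.range γ := by
  refine ⟨?_, fun hz n hn ↦ hp.iterate_ne_of_notMem_range hz hn⟩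
  rintro h ⟨i, rfl⟩
  exact h k hk (by rw [hp.iterate_cycle, ZMod.natCast_self, add_zero])

lemma card_nonperiodic [Finite V] (hp : IsCycleRetraction Γ γ p) (hinj : Function.Injective γ)
    (hk : 0 < k) : Nat.card {z : V // ∀ n, 0 < n → p^[n] z ≠ z} = Nat.card V - k := by
  have h : {z : V | ∀ n, 0 < n → p^[n] z ≠ z} = (Set.range γ)ᶜ :=
    Set.ext (hp.nonperiodic_iff hk)
  change Nat.card ({z : V | ∀ n, 0 < n → p^[n] z ≠ z} : Set V) = _
  rw [h, Nat.card_coe_set_eq, Set.ncard_compl, ← Set.image_univ,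
    Set.ncard_image_of_injective _ hinj, Set.ncard_univ, Nat.card_zmod]

lemma isParentMap [Finite V] (hp : IsCycleRetraction Γ γ p) (hinj : Function.Injective γ)
    (hk : 4 ≤ k) (hchi : Nat.card V = Nat.card Γ.edgeSet) : IsParentMap Γ p := by
  have hne2 (z : V) : p (p z) ≠ z := hp.iterate_ne hinj z (n := 2) (by lia) (by lia)
  let edge (z : V) : Γ.edgeSet := ⟨s(z, p z), hp.adj z⟩
  have hedge : Function.Injective edge := by
    intro z w h
    rcases Sym2.eq_iff.1 (congrArg Subtype.val h) with ⟨h, -⟩ | ⟨rfl, h⟩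
    · exact h
    · exact absurd h (hne2 w)
  have hsurj : Function.Surjective edge :=
    (hedge.bijective_of_nat_card_le hchi.ge).2
  refine ⟨fun z w ↦ ⟨fun h ↦ ?_, ?_⟩, fun z ↦ (hp.adj z).ne', hne2,
    fun z ↦ hp.iterate_ne hinj z (n := 3) (by lia) (by lia)⟩
  · obtain ⟨u, hu⟩ := hsurj ⟨s(z, w), h⟩
    rcases Sym2.eq_iff.1 (congrArg Subtype.val hu) with ⟨rfl, hw⟩ | ⟨rfl, hz⟩
    · exact Or.inl hw
    · exact Or.inr hz
  · rintro (rfl | rfl)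
    · exact hp.adj z
    · exact (hp.adj w).symm

end IsCycleRetraction

end CycleParent

/-- Let `Γ` be a finite connected simple graph with Euler
characteristic 0 (the number of vertices equals the number `e` of edges), whose
unique simple cycle has length `k ≥ 5`, and let `ℓ` be the number of leaves of
`Γ`.  Then `Out(A_Γ)` contains a free abelian subgroup of rank `e - k + 2ℓ`. -/
theorem out_raag_lower_bound_euler_zero
    {V : Type*} [Fintype V] (Γ : SimpleGraph V)
    (hconn : Γ.Connected)
    (hchi : Nat.card V = Nat.card Γ.edgeSet)
    (k : ℕ) (hk : 5 ≤ k)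
    (hcycle : ∃ (v : V) (c : Γ.Walk v v), c.IsCycle ∧ c.length = k)
    (huniq : ∀ (v : V) (c : Γ.Walk v v), c.IsCycle → c.length = k) :
    HasFreeAbelianSubgroupOfRank (OutG (RAAG Γ))
      (Nat.card Γ.edgeSet - k + 2 * numLeaves Γ) := by
  obtain ⟨v, c, hc, rfl⟩ := hcycle
  obtain ⟨γ, hinj, hadj⟩ := hc.exists_zmod_param
  obtain ⟨p, hret⟩ := exists_isCycleRetraction hconn hinj hadj
  have hp : IsParentMap Γ p := hret.isParentMap hinj (by lia) hchi
  have : Fintype (IsParentMap.TwistIndex Γ p) := Fintype.ofFinite _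
  have hcard : Nat.card (IsParentMap.TwistIndex Γ p) =
      Nat.card Γ.edgeSet - c.length + 2 * numLeaves Γ := by
    rw [Nat.card_sum, Nat.card_prod, hret.card_nonperiodic hinj (by lia), hchi,
      Nat.card_eq_fintype_card (α := Bool), Fintype.card_bool, mul_comm]
    rfl
  rw [← hcard]
  exact hasFreeAbelianSubgroupOfRank_of_injective _ hp.outMk_comp_twistHom_injective
end

section
/- Let Γ be a finite tree, v a non-leaf vertex, L_v its set of neighbors, and V_0 the set of non-leaf vertices of Γ. Let F(L_v) be the free group on L_v and ι : F(L_v) → A_Γ the homomorphism sending each generator to the corresponding generator of A_Γ. Suppose φ is an automorphism of F(L_v) and for each w ∈ L_v ∩ V_0 an element g_w ∈ F(L_v) is given with φ(w) = g_w w g_w⁻¹. Then there is an automorphism φ̂ of A_Γ with: φ̂(v) = v; φ̂(w) = ι(φ(w)) for every w ∈ L_v; and for every vertex u ∉ {v} ∪ L_v, φ̂(u) = ι(g_w) u ι(g_w)⁻¹, where w is the unique element of L_v lying in the same connected component of Γ ∖ {v} as u. -/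
/-- The homomorphism `ι : F(L_v) → A_Γ` sending each generator (a neighbor of
`v`) to the corresponding generator of `A_Γ`. -/
def iotaNbr {V : Type*} (Γ : SimpleGraph V) (v : V) :
    FreeGroup (Γ.neighborSet v) →* RAAG Γ :=
  FreeGroup.lift fun w => raagGen Γ w.val

/-- In an acyclic graph, two neighbors of `v` joined by a walk avoiding `v` coincide. -/
theorem SimpleGraph.IsAcyclic.eq_of_reachAvoid {V : Type*} {Γ : SimpleGraph V}
    (hΓ : Γ.IsAcyclic) {v a b : V} (ha : Γ.Adj v a) (hb : Γ.Adj v b)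
    (h : ReachAvoid Γ v a b) : a = b := by
  classical
  obtain ⟨p, hp⟩ := h
  have hp' : v ∉ p.bypass.support := fun h => hp (p.support_bypass_subset_support h)
  have h₁ : (SimpleGraph.Walk.cons ha p.bypass).IsPath := p.bypass_isPath.cons hp'
  have h₂ : (SimpleGraph.Walk.cons hb SimpleGraph.Walk.nil).IsPath :=
    SimpleGraph.Walk.IsPath.nil.cons (by simpa using hb.ne)
  have h₃ := congrArg (fun q => q.1.length)
    ((hΓ.subsingleton_path v b).elim ⟨_, h₁⟩ ⟨_, h₂⟩)
  simp only [SimpleGraph.Walk.length_cons, SimpleGraph.Walk.length_nil] at h₃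
  exact SimpleGraph.Walk.eq_of_length_eq_zero (p := p.bypass) (by omega)

theorem ReachAvoid.symm {V : Type*} {Γ : SimpleGraph V} {v a b : V}
    (h : ReachAvoid Γ v a b) : ReachAvoid Γ v b a := by
  obtain ⟨p, hp⟩ := h
  exact ⟨p.reverse, by simpa using hp⟩

theorem ReachAvoid.trans {V : Type*} {Γ : SimpleGraph V} {v a b c : V}
    (h : ReachAvoid Γ v a b) (h' : ReachAvoid Γ v b c) : ReachAvoid Γ v a c := by
  obtain ⟨p, hp⟩ := h
  obtain ⟨q, hq⟩ := h'
  exact ⟨p.append q, by simp [SimpleGraph.Walk.mem_support_append_iff, hp, hq]⟩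

theorem ReachAvoid.refl {V : Type*} {Γ : SimpleGraph V} {v a : V} (h : a ≠ v) :
    ReachAvoid Γ v a a :=
  ⟨SimpleGraph.Walk.nil, by simpa using h.symm⟩

theorem ReachAvoid.of_adj {V : Type*} {Γ : SimpleGraph V} {v a b : V} (h : Γ.Adj a b)
    (ha : a ≠ v) (hb : b ≠ v) : ReachAvoid Γ v a b :=
  ⟨SimpleGraph.Walk.cons h SimpleGraph.Walk.nil, by simpa using ⟨ha.symm, hb.symm⟩⟩

/-- In a connected graph, every vertex other than `v` is joined to a neighbor of `v` by a walk
avoiding `v`. -/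
theorem SimpleGraph.Connected.exists_reachAvoid {V : Type*} {Γ : SimpleGraph V}
    (hΓ : Γ.Connected) {v u : V} (hu : u ≠ v) :
    ∃ w : Γ.neighborSet v, ReachAvoid Γ v u w.val := by
  obtain ⟨p, hp⟩ := (hΓ v u).exists_isPath
  cases p with
  | nil => exact absurd rfl hu
  | cons h q =>
    rw [SimpleGraph.Walk.cons_isPath_iff] at hp
    exact ⟨⟨_, h⟩, ReachAvoid.symm ⟨q, hp.2⟩⟩

theorem IsLeaf.eq_of_adj {V : Type*} {Γ : SimpleGraph V} {w a b : V} (hw : IsLeaf Γ w)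
    (ha : Γ.Adj w a) (hb : Γ.Adj w b) : a = b := by
  obtain ⟨c, hc⟩ := Set.ncard_eq_one.mp hw
  have ha' : a ∈ Γ.neighborSet w := ha
  have hb' : b ∈ Γ.neighborSet w := hb
  rw [hc] at ha' hb'
  exact ha'.trans hb'.symm

theorem raagGen_commute {V : Type*} {Γ : SimpleGraph V} {a b : V} (h : Γ.Adj a b) :
    Commute (raagGen Γ a) (raagGen Γ b) := by
  have h₁ : PresentedGroup.mk (raagRels Γ) (FreeGroup.of a * FreeGroup.of b *
      (FreeGroup.of a)⁻¹ * (FreeGroup.of b)⁻¹) = 1 :=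
    PresentedGroup.one_of_mem ⟨a, b, h, rfl⟩
  simp only [map_mul, map_inv] at h₁
  exact mul_inv_eq_iff_eq_mul.mp (mul_inv_eq_one.mp h₁)

/-- A map on vertices sending adjacent vertices to commuting elements extends to the
right-angled Artin group. -/
theorem exists_raagHom {V : Type*} {Γ : SimpleGraph V} {G : Type*} [Group G] (f : V → G)
    (hf : ∀ a b, Γ.Adj a b → Commute (f a) (f b)) :
    ∃ ψ : RAAG Γ →* G, ∀ u, ψ (raagGen Γ u) = f u := by
  refine ⟨PresentedGroup.toGroup (f := f) ?_, fun u => PresentedGroup.toGroup.of _⟩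
  rintro r ⟨a, b, h, rfl⟩
  simp [(hf a b h).eq]

theorem iotaNbr_of {V : Type*} (Γ : SimpleGraph V) (v : V) (w : Γ.neighborSet v) :
    iotaNbr Γ v (FreeGroup.of w) = raagGen Γ w.val := by
  simp [iotaNbr]

theorem commute_iotaNbr {V : Type*} (Γ : SimpleGraph V) (v : V)
    (x : FreeGroup (Γ.neighborSet v)) : Commute (raagGen Γ v) (iotaNbr Γ v x) := by
  induction x using FreeGroup.induction_on with
  | C1 => simp
  | of w => rw [iotaNbr_of]; exact raagGen_commute w.2
  | inv_of w h => rw [map_inv]; exact h.inv_right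
  | mul x y hx hy => rw [map_mul]; exact hx.mul_right hy

/-- An endomorphism of `F(L_v)` that conjugates each non-leaf neighbor `w` by `g w` lifts to an
endomorphism of the right-angled Artin group of a tree. -/
theorem exists_lift_partially_symmetric_endomorphism {V : Type*} {Γ : SimpleGraph V}
    (hΓ : Γ.IsTree) (v : V)
    (φ : FreeGroup (Γ.neighborSet v) →* FreeGroup (Γ.neighborSet v))
    (g : Γ.neighborSet v → FreeGroup (Γ.neighborSet v))
    (hg : ∀ w : Γ.neighborSet v, ¬ IsLeaf Γ w.val →
      φ (FreeGroup.of w) = g w * FreeGroup.of w * (g w)⁻¹) :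
    ∃ ψ : RAAG Γ →* RAAG Γ,
      ψ (raagGen Γ v) = raagGen Γ v ∧
      (∀ x, ψ (iotaNbr Γ v x) = iotaNbr Γ v (φ x)) ∧
      (∀ u : V, u ≠ v → u ∉ Γ.neighborSet v →
        ∀ w : Γ.neighborSet v, ReachAvoid Γ v u w.val →
          ψ (raagGen Γ u) =
            iotaNbr Γ v (g w) * raagGen Γ u * (iotaNbr Γ v (g w))⁻¹) := by
  classical
  choose r hr using fun (u : V) (hu : u ≠ v) => hΓ.connected.exists_reachAvoid hu
  have hr_eq : ∀ (u : V) (hu : u ≠ v) (w : Γ.neighborSet v), ReachAvoid Γ v u w.val →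
      r u hu = w := fun u hu w h =>
    Subtype.ext (hΓ.isAcyclic.eq_of_reachAvoid (r u hu).2 w.2 ((hr u hu).symm.trans h))
  let f : V → RAAG Γ := fun u =>
    if hu : u = v then raagGen Γ v
    else if hn : u ∈ Γ.neighborSet v then iotaNbr Γ v (φ (FreeGroup.of ⟨u, hn⟩))
    else iotaNbr Γ v (g (r u hu)) * raagGen Γ u * (iotaNbr Γ v (g (r u hu)))⁻¹
  have f_self : f v = raagGen Γ v := by simp [f]
  have f_nbr : ∀ w : Γ.neighborSet v, f w.val = iotaNbr Γ v (φ (FreeGroup.of w)) := fun w => by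
    have h₁ : w.val ≠ v := w.2.ne'
    have h₂ : w.val ∈ Γ.neighborSet v := w.2
    simp only [f, dif_neg h₁, dif_pos h₂]
  have f_far : ∀ (u : V), u ≠ v → u ∉ Γ.neighborSet v → ∀ w : Γ.neighborSet v,
      ReachAvoid Γ v u w.val →
      f u = iotaNbr Γ v (g w) * raagGen Γ u * (iotaNbr Γ v (g w))⁻¹ := fun u hu hn w h => by
    simp only [f, dif_neg hu, dif_neg hn, hr_eq u hu w h]
  have f_conj : ∀ a b : V, a ≠ v → b ≠ v → Γ.Adj a b → ∀ w : Γ.neighborSet v,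
      ReachAvoid Γ v a w.val →
      f a = iotaNbr Γ v (g w) * raagGen Γ a * (iotaNbr Γ v (g w))⁻¹ := by
    intro a b ha hb hab w h
    by_cases hn : a ∈ Γ.neighborSet v
    · obtain rfl : a = w.val := hΓ.isAcyclic.eq_of_reachAvoid hn w.2 h
      have hl : ¬ IsLeaf Γ w.val := fun hl => hb (hl.eq_of_adj hab w.2.symm)
      rw [f_nbr w, hg w hl, map_mul, map_mul, map_inv, iotaNbr_of]
    · exact f_far a ha hn w h
  have f_comm : ∀ a b, Γ.Adj a b → Commute (f a) (f b) := by
    intro a b hab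
    by_cases ha : a = v
    · subst ha
      rw [f_self, f_nbr ⟨b, hab⟩]
      exact commute_iotaNbr Γ a _
    by_cases hb : b = v
    · subst hb
      rw [f_self, f_nbr ⟨a, hab.symm⟩]
      exact (commute_iotaNbr Γ b _).symm
    have hw := hr a ha
    rw [f_conj a b ha hb hab _ hw, f_conj b a hb ha hab.symm _
      ((ReachAvoid.of_adj hab ha hb).symm.trans hw)]
    exact Commute.conj_iff _ |>.mpr (raagGen_commute hab)
  obtain ⟨ψ, hψ⟩ := exists_raagHom f f_comm
  refine ⟨ψ, (hψ v).trans f_self, fun x => ?_, fun u hu hn w h => (hψ u).trans (f_far u hu hn w h)⟩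
  have h : ψ.comp (iotaNbr Γ v) = (iotaNbr Γ v).comp φ :=
    FreeGroup.ext_hom _ _ fun w => by
      rw [MonoidHom.comp_apply, MonoidHom.comp_apply, iotaNbr_of, hψ, f_nbr]
  exact DFunLike.congr_fun h x

/-- Lifts of mutually inverse endomorphisms, with matching conjugators, are inverse. -/
theorem lift_comp_lift_eq_id {V : Type*} {Γ : SimpleGraph V} (hΓ : Γ.IsTree) (v : V)
    {φ φ' : FreeGroup (Γ.neighborSet v) →* FreeGroup (Γ.neighborSet v)}
    {g g' : Γ.neighborSet v → FreeGroup (Γ.neighborSet v)}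
    (hφ : ∀ x, φ' (φ x) = x) (hg : ∀ w, φ' (g w) * g' w = 1)
    {ψ ψ' : RAAG Γ →* RAAG Γ}
    (hv : ψ (raagGen Γ v) = raagGen Γ v) (hv' : ψ' (raagGen Γ v) = raagGen Γ v)
    (hι : ∀ x, ψ (iotaNbr Γ v x) = iotaNbr Γ v (φ x))
    (hι' : ∀ x, ψ' (iotaNbr Γ v x) = iotaNbr Γ v (φ' x))
    (hfar : ∀ u : V, u ≠ v → u ∉ Γ.neighborSet v →
      ∀ w : Γ.neighborSet v, ReachAvoid Γ v u w.val →
        ψ (raagGen Γ u) = iotaNbr Γ v (g w) * raagGen Γ u * (iotaNbr Γ v (g w))⁻¹)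
    (hfar' : ∀ u : V, u ≠ v → u ∉ Γ.neighborSet v →
      ∀ w : Γ.neighborSet v, ReachAvoid Γ v u w.val →
        ψ' (raagGen Γ u) = iotaNbr Γ v (g' w) * raagGen Γ u * (iotaNbr Γ v (g' w))⁻¹) :
    ψ'.comp ψ = MonoidHom.id _ := by
  refine PresentedGroup.ext fun u => ?_
  change ψ' (ψ (raagGen Γ u)) = raagGen Γ u
  by_cases hu : u = v
  · rw [hu, hv, hv']
  by_cases hn : u ∈ Γ.neighborSet v
  · rw [← iotaNbr_of Γ v ⟨u, hn⟩, hι, hι', hφ]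
  obtain ⟨w, hw⟩ := hΓ.connected.exists_reachAvoid hu
  have h : iotaNbr Γ v (φ' (g w)) * iotaNbr Γ v (g' w) = 1 := by rw [← map_mul, hg, map_one]
  rw [hfar u hu hn w hw, map_mul, map_mul, map_inv, hι', hfar' u hu hn w hw,
    eq_inv_of_mul_eq_one_left h]
  group

/-- Let `Γ` be a finite tree, `v` a non-leaf vertex, `L_v` its
set of neighbors, and `V₀` the set of non-leaf vertices of `Γ`.  Let `F(L_v)`
be the free group on `L_v` and `ι : F(L_v) → A_Γ` the homomorphism sending each
generator to the corresponding generator of `A_Γ`.  Suppose `φ` is an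
automorphism of `F(L_v)` and for each `w ∈ L_v ∩ V₀` an element
`g w ∈ F(L_v)` is given with `φ(w) = g_w w g_w⁻¹`.  Then there is an
automorphism `φ̂` of `A_Γ` with: `φ̂(v) = v`; `φ̂(w) = ι(φ(w))` for every
`w ∈ L_v`; and for every vertex `u ∉ {v} ∪ L_v`, `φ̂(u) = ι(g_w) u ι(g_w)⁻¹`,
where `w` is the unique element of `L_v` lying in the same connected component
of `Γ ∖ {v}` as `u`. -/
theorem lift_partially_symmetric_automorphism_tree
    {V : Type*} [Fintype V] (Γ : SimpleGraph V) (hΓ : Γ.IsTree)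
    (v : V) (hv : ¬ IsLeaf Γ v)
    (φ : MulAut (FreeGroup (Γ.neighborSet v)))
    (g : Γ.neighborSet v → FreeGroup (Γ.neighborSet v))
    (hg : ∀ w : Γ.neighborSet v, ¬ IsLeaf Γ w.val →
      φ (FreeGroup.of w) = g w * FreeGroup.of w * (g w)⁻¹) :
    ∃ φhat : MulAut (RAAG Γ),
      φhat (raagGen Γ v) = raagGen Γ v ∧
      (∀ w : Γ.neighborSet v,
        φhat (raagGen Γ w.val) = iotaNbr Γ v (φ (FreeGroup.of w))) ∧
      (∀ u : V, u ≠ v → u ∉ Γ.neighborSet v →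
        ∀ w : Γ.neighborSet v, ReachAvoid Γ v u w.val →
          φhat (raagGen Γ u) =
            iotaNbr Γ v (g w) * raagGen Γ u * (iotaNbr Γ v (g w))⁻¹) := by
  obtain ⟨ψ, hv₁, hι₁, hfar₁⟩ :=
    exists_lift_partially_symmetric_endomorphism hΓ v φ.toMonoidHom g hg
  obtain ⟨ψ', hv₂, hι₂, hfar₂⟩ :=
    exists_lift_partially_symmetric_endomorphism hΓ v φ.symm.toMonoidHom
      (fun w => (φ.symm (g w))⁻¹) fun w hw => by
        change φ.symm _ = _
        rw [MulEquiv.symm_apply_eq]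
        simp [hg w hw, mul_assoc]
  refine ⟨MonoidHom.toMulEquiv ψ ψ'
    (lift_comp_lift_eq_id hΓ v (fun x => φ.symm_apply_apply x) (fun w => mul_inv_cancel _)
      hv₁ hv₂ hι₁ hι₂ hfar₁ hfar₂)
    (lift_comp_lift_eq_id hΓ v (fun x => φ.apply_symm_apply x) (fun w => by simp)
      hv₂ hv₁ hι₂ hι₁ hfar₂ hfar₁), hv₁, fun w => ?_, hfar₁⟩
  rw [← iotaNbr_of]
  exact hι₁ _
end
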